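/- arXiv:math/0410058 — 2 statements merged into one kernel-verified Lean document; each statement's English description precedes it below -/
import Mathlib

section
/- Fix real numbers S_2, ..., S_n > 0 with n ≥ 3. Define G(s) = s · sinh(Σ_{i=2}^n arcsinh(S_i/s)) for s > 0. Then G is strictly decreasing on (0, ∞); in particular for any S_1 > 0 there is at most one s > 0 with G(s) = S_1. -/
open Real in
theorem hyp_step {ι : Type*} [DecidableEq ι] (S : ι → ℝ) (a : ι) (T : Finset ι) (ha : a ∉ T)
    {s : ℝ} (hs : 0 < s) :
    s * sinh (∑ i ∈ insert a T, arsinh (S i / s)) =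
      S a * cosh (∑ i ∈ T, arsinh (S i / s)) +
        cosh (arsinh (S a / s)) * (s * sinh (∑ i ∈ T, arsinh (S i / s))) := by
  rw [Finset.sum_insert ha, sinh_add, sinh_arsinh]
  field_simp

theorem arsinh_div_lt {x s t : ℝ} (hx : 0 < x) (hs : 0 < s) (hst : s < t) :
    Real.arsinh (x / t) < Real.arsinh (x / s) :=
  Real.arsinh_lt_arsinh.2 (div_lt_div_of_pos_left hx hs hst)

theorem hyp_sum_nonneg {ι : Type*} (S : ι → ℝ) (hS : ∀ i, 0 < S i) (T : Finset ι)
    {s : ℝ} (hs : 0 < s) : 0 ≤ ∑ i ∈ T, Real.arsinh (S i / s) :=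
  Finset.sum_nonneg fun i _ => Real.arsinh_nonneg_iff.2 (div_pos (hS i) hs).le

theorem cosh_le_of_nonneg {x y : ℝ} (hx : 0 ≤ x) (h : x ≤ y) : Real.cosh x ≤ Real.cosh y := by
  rw [Real.cosh_le_cosh, abs_of_nonneg hx, abs_of_nonneg (hx.trans h)]
  exact h

theorem cosh_lt_of_nonneg {x y : ℝ} (hx : 0 ≤ x) (h : x < y) : Real.cosh x < Real.cosh y := by
  rw [Real.cosh_lt_cosh, abs_of_nonneg hx, abs_of_nonneg (hx.trans h.le)]
  exact h

open Real in
theorem hyp_second {ι : Type*} (S : ι → ℝ) (hS : ∀ i, 0 < S i) (a : ι) (T : Finset ι)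
    {s t : ℝ} (hs : 0 < s) (hst : s < t)
    (ih : t * sinh (∑ i ∈ T, arsinh (S i / t)) ≤ s * sinh (∑ i ∈ T, arsinh (S i / s))) :
    cosh (arsinh (S a / t)) * (t * sinh (∑ i ∈ T, arsinh (S i / t))) ≤
      cosh (arsinh (S a / s)) * (s * sinh (∑ i ∈ T, arsinh (S i / s))) := by
  have ht := hs.trans hst
  refine mul_le_mul (cosh_le_of_nonneg ?_ (arsinh_div_lt (hS a) hs hst).le) ih ?_ (cosh_pos _).le
  · exact arsinh_nonneg_iff.2 (div_pos (hS a) ht).le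
  · exact mul_nonneg ht.le (sinh_nonneg_iff.2 (hyp_sum_nonneg S hS T ht))

open Real in
theorem hyp_le {ι : Type*} [DecidableEq ι] (S : ι → ℝ) (hS : ∀ i, 0 < S i) (T : Finset ι)
    {s t : ℝ} (hs : 0 < s) (hst : s < t) :
    t * sinh (∑ i ∈ T, arsinh (S i / t)) ≤ s * sinh (∑ i ∈ T, arsinh (S i / s)) := by
  induction T using Finset.induction_on with
  | empty => simp
  | insert a T ha ih =>
    have ht := hs.trans hst
    rw [hyp_step S a T ha hs, hyp_step S a T ha ht]
    refine add_le_add (mul_le_mul_of_nonneg_left ?_ (hS a).le) (hyp_second S hS a T hs hst ih)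
    exact cosh_le_of_nonneg (hyp_sum_nonneg S hS T ht)
      (Finset.sum_le_sum fun i _ => (arsinh_div_lt (hS i) hs hst).le)

/-- for fixed positive `S i` (at least two of them), the function
`G s = s * sinh (∑ arsinh (S i / s))` is strictly decreasing on `(0, ∞)`; in particular
for any `S₁ > 0` there is at most one `s > 0` with `G s = S₁`. -/
theorem strictAnti_hypercycle_function
    {ι : Type*} [Fintype ι] (h2 : 2 ≤ Fintype.card ι)
    (S : ι → ℝ) (hS : ∀ i, 0 < S i)
    (G : ℝ → ℝ) (hG : ∀ s, G s = s * Real.sinh (∑ i, Real.arsinh (S i / s))) :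
    StrictAntiOn G (Set.Ioi 0) ∧
      ∀ S₁ : ℝ, 0 < S₁ → ∀ s ∈ Set.Ioi (0:ℝ), ∀ t ∈ Set.Ioi (0:ℝ),
        G s = S₁ → G t = S₁ → s = t := by
  classical
  have hanti : StrictAntiOn G (Set.Ioi 0) := by
    intro s hs t _ hst
    have hs : 0 < s := hs
    have ht : 0 < t := hs.trans hst
    obtain ⟨a, b, hab⟩ := Fintype.one_lt_card_iff.1 (show 1 < Fintype.card ι by omega)
    have ha : a ∉ Finset.univ.erase a := Finset.notMem_erase a _
    have hb : b ∈ Finset.univ.erase a := Finset.mem_erase.2 ⟨hab.symm, Finset.mem_univ b⟩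
    rw [hG, hG, ← Finset.insert_erase (Finset.mem_univ a), hyp_step S a _ ha hs,
      hyp_step S a _ ha ht]
    refine add_lt_add_of_lt_of_le (mul_lt_mul_of_pos_left ?_ (hS a))
      (hyp_second S hS a _ hs hst (hyp_le S hS _ hs hst))
    exact cosh_lt_of_nonneg (hyp_sum_nonneg S hS _ ht)
      (Finset.sum_lt_sum_of_nonempty ⟨b, hb⟩ fun i _ => arsinh_div_lt (hS i) hs hst)
  exact ⟨hanti, fun S₁ _ s hs t ht h1 h2 => hanti.injOn hs ht (h1.trans h2.symm)⟩
end

section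
/- Let p = (v_1, ..., v_n) be a convex spherical polygon and U a non-trivial isometric first-order deformation of p. Then b(U) := Σ_{i=1}^n dα_i(U) dv_i(U) ∈ ℝ³ satisfies ⟨b(U), v_j⟩ > 0 for every vertex v_j of p; equivalently, b(U) lies in the open positive cone over the interior of the dual polygon p*. -/
/-- Euclidean dot product on `ℝ³`. -/
def dot3 (x y : Fin 3 → ℝ) : ℝ := x 0 * y 0 + x 1 * y 1 + x 2 * y 2

/-- Euclidean cross product on `ℝ³`. -/
def cross3 (x y : Fin 3 → ℝ) : Fin 3 → ℝ :=
  ![x 1 * y 2 - x 2 * y 1, x 2 * y 0 - x 0 * y 2, x 0 * y 1 - x 1 * y 0]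

lemma exists_killing (v w dv dw : Fin 3 → ℝ) (hv : dot3 v v = 1)
    (hN : dot3 (cross3 v w) (cross3 v w) ≠ 0)
    (h1 : dot3 dv v = 0) (h2 : dot3 dw w = 0) (h3 : dot3 dv w + dot3 v dw = 0) :
    ∃ Y : Fin 3 → ℝ, dv = cross3 Y v ∧ dw = cross3 Y w := by
  set N := cross3 v w with hNdef
  set x := dw - cross3 (cross3 v dv) w with hx
  have hxw : dot3 x w = 0 := by
    rw [← h2, hx]; simp [dot3, cross3]; ring
  have hxv : dot3 x v = 0 := by
    simp only [hx]; simp [dot3, cross3] at *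
    linear_combination h3 + (w 0 * dv 0 + w 1 * dv 1 + w 2 * dv 2) * hv -
      (v 0 * w 0 + v 1 * w 1 + v 2 * w 2) * h1
  have hcross : ∀ k, dot3 N N * x k = dot3 x N * N k := by
    have e : ∀ k, dot3 N N * x k - dot3 x N * N k = 
        (dot3 x v) * ((dot3 w w) * v k - dot3 v w * w k)
        + (dot3 x w) * ((dot3 v v) * w k - dot3 v w * v k) := by
      intro k
      rw [hNdef]
      generalize x = x'
      fin_cases k <;> simp [dot3, cross3] <;> ring
    intro k
    have := e k
    rw [hxv, hxw] at this
    linarith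
  refine ⟨cross3 v dv + (dot3 x N / dot3 N N) • v, ?_, ?_⟩
  · generalize dot3 x N / dot3 N N = l
    simp only [dot3] at hv h1
    ext k; fin_cases k <;> simp [cross3]
    · linear_combination -dv 0 * hv + v 0 * h1
    · linear_combination -dv 1 * hv + v 1 * h1
    · linear_combination -dv 2 * hv + v 2 * h1
  · have hl : ∀ k, x k = (dot3 x N / dot3 N N) * N k := by
      intro k
      have := hcross k
      field_simp
      linarith
    generalize dot3 x N / dot3 N N = l at hl
    have h0 := hl 0
    have h1 := hl 1
    have h2 := hl 2
    simp only [hx, hNdef] at h0 h1 h2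
    simp [cross3] at h0 h1 h2
    ext k; fin_cases k <;> simp [cross3]
    · linear_combination h0
    · linear_combination h1
    · linear_combination h2

lemma parallel_of_cross (D v : Fin 3 → ℝ) (hv : dot3 v v = 1) (h : cross3 D v = 0) :
    D = (dot3 D v) • v := by
  have h0 := congrFun h 0
  have h1 := congrFun h 1
  have h2 := congrFun h 2
  simp [cross3] at h0 h1 h2
  simp only [dot3] at hv
  ext k; fin_cases k <;> simp [dot3]
  · linear_combination -D 0 * hv + v 1 * h2 - v 2 * h1
  · linear_combination -D 1 * hv + v 2 * h0 - v 0 * h2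
  · linear_combination -D 2 * hv + v 0 * h1 - v 1 * h0

lemma cross_sq_pos (v w z : Fin 3 → ℝ) (h : 0 < dot3 (cross3 v w) z) :
    dot3 (cross3 v w) (cross3 v w) ≠ 0 := by
  intro h0
  generalize cross3 v w = N at *
  simp only [dot3] at h0 h
  have a : N 0 = 0 := by nlinarith [sq_nonneg (N 0), sq_nonneg (N 1), sq_nonneg (N 2)]
  have b : N 1 = 0 := by nlinarith [sq_nonneg (N 0), sq_nonneg (N 1), sq_nonneg (N 2)]
  have c : N 2 = 0 := by nlinarith [sq_nonneg (N 0), sq_nonneg (N 1), sq_nonneg (N 2)]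
  simp [a, b, c] at h

lemma hasDerivAt_dot3 {f g : ℝ → Fin 3 → ℝ} {f' g' : Fin 3 → ℝ}
    (hf : HasDerivAt f f' 0) (hg : HasDerivAt g g' 0) :
    HasDerivAt (fun t => dot3 (f t) (g t)) (dot3 f' (g 0) + dot3 (f 0) g') 0 := by
  have F := hasDerivAt_pi.1 hf
  have G := hasDerivAt_pi.1 hg
  have := (((F 0).mul (G 0)).add ((F 1).mul (G 1))).add ((F 2).mul (G 2))
  refine this.congr_deriv ?_
  simp only [dot3]; ring

lemma zmod_const {n : ℕ} [NeZero n] {X : Type*} (Y : ZMod n → X)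
    (h : ∀ m, Y (m - 1) = Y m) (m : ZMod n) : Y m = Y 0 := by
  have : ∀ k : ℕ, Y (k : ZMod n) = Y 0 := by
    intro k
    induction k with
    | zero => simp
    | succ k ih => rw [← ih, ← h]; simp
  rw [← ZMod.natCast_zmod_val m]; exact this _

lemma sum_shift {n : ℕ} [NeZero n] {X : Type*} [AddCommGroup X] (F : ZMod n → X) :
    ∑ m, (F (m - 1) - F m) = 0 := by
  rw [Finset.sum_sub_distrib, sub_eq_zero]
  exact (Equiv.subRight (1 : ZMod n)).sum_comp F

/-- Theorem B_S: let `p` be a convex spherical polygon with vertices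
`v 0 i ∈ S² ⊂ ℝ³` undergoing a non-trivial isometric first-order deformation `U`
(vertex variations `dv i`, induced angle variations `dα i`).  Then
`b(U) = ∑ dα i • dv i` has positive scalar product with every vertex `v 0 j`; i.e.
`b(U)` lies in the open positive cone over the interior of the dual polygon `p*`. -/
theorem bU_positive
    (n : ℕ) [NeZero n] (hn : 3 ≤ n)
    (v : ℝ → ZMod n → (Fin 3 → ℝ)) (α : ℝ → ZMod n → ℝ)
    (hunit : ∀ t i, dot3 (v t i) (v t i) = 1)
    (hne : ∀ t i, v t i ≠ v t (i + 1))
    (hna : ∀ t i, v t i ≠ -v t (i + 1))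
    -- the deformation is isometric: edge lengths are constant in `t`
    (hiso : ∀ t i, dot3 (v t i) (v t (i + 1)) = dot3 (v 0 i) (v 0 (i + 1)))
    -- the (oriented) angle `α t i` at vertex `i` is determined by its cosine and sine:
    (hcos : ∀ t i,
      Real.cos (α t i) * Real.sqrt (1 - (dot3 (v t (i - 1)) (v t i)) ^ 2)
          * Real.sqrt (1 - (dot3 (v t i) (v t (i + 1))) ^ 2)
        = dot3 (v t (i - 1)) (v t (i + 1))
          - dot3 (v t (i - 1)) (v t i) * dot3 (v t i) (v t (i + 1)))
    (hsin : ∀ t i,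
      Real.sin (α t i) * Real.sqrt (1 - (dot3 (v t (i - 1)) (v t i)) ^ 2)
          * Real.sqrt (1 - (dot3 (v t i) (v t (i + 1))) ^ 2)
        = dot3 (v t i) (cross3 (v t (i + 1)) (v t (i - 1))))
    -- the polygon at `t = 0` is (strictly) convex:
    (hconvex : ∀ i m : ZMod n, m ≠ i → m ≠ i + 1 →
      0 < dot3 (cross3 (v 0 i) (v 0 (i + 1))) (v 0 m))
    (dv : ZMod n → Fin 3 → ℝ)
    (hdv : ∀ i, HasDerivAt (fun t => v t i) (dv i) 0)
    (dα : ZMod n → ℝ)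
    (hdα : ∀ i, HasDerivAt (fun t => α t i) (dα i) 0)
    -- the deformation is non-trivial: it is not induced by a Killing field of `S²`
    (hnontriv : ¬ ∃ Y : Fin 3 → ℝ, ∀ i, dv i = cross3 Y (v 0 i)) :
    ∀ j : ZMod n, 0 < dot3 (∑ i : ZMod n, dα i • dv i) (v 0 j) := by
  have one_ne : (1 : ZMod n) ≠ 0 := by
    intro h
    have := (ZMod.natCast_eq_zero_iff 1 n).1 (by simpa using h)
    have := Nat.le_of_dvd (by norm_num) this
    omega
  have two_ne : (2 : ZMod n) ≠ 0 := by
    intro h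
    have := (ZMod.natCast_eq_zero_iff 2 n).1 (by simpa using h)
    have := Nat.le_of_dvd (by norm_num) this
    omega
  have pm_ne : ∀ i : ZMod n, i - 1 ≠ i := fun i h => one_ne (by linear_combination -h)
  have pp_ne : ∀ i : ZMod n, i - 1 ≠ i + 1 := fun i h => two_ne (by linear_combination -h)
  have hdet : ∀ i, 0 < dot3 (cross3 (v 0 i) (v 0 (i + 1))) (v 0 (i - 1)) :=
    fun i => hconvex i (i - 1) (pm_ne i) (pp_ne i)
  -- the Killing field of each edge
  have hY : ∀ i, ∃ Y : Fin 3 → ℝ, dv i = cross3 Y (v 0 i) ∧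
      dv (i + 1) = cross3 Y (v 0 (i + 1)) := by
    have horth : ∀ i, dot3 (dv i) (v 0 i) = 0 := by
      intro i
      have h1 := hasDerivAt_dot3 (hdv i) (hdv i)
      simp only [hunit] at h1
      have := h1.unique (hasDerivAt_const 0 1)
      simp only [dot3] at *
      linarith
    intro i
    refine exists_killing _ _ _ _ (hunit 0 i) (cross_sq_pos _ _ _ (hdet i)) (horth i)
      (horth _) ?_
    have h1 := hasDerivAt_dot3 (hdv i) (hdv (i + 1))
    simp only [hiso] at h1
    exact h1.unique (hasDerivAt_const 0 _)
  choose Y hY1 hY2 using hY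
  have hY2' : ∀ i, dv i = cross3 (Y (i - 1)) (v 0 i) := by
    intro i; simpa using hY2 (i - 1)
  have hpar : ∀ i, Y (i - 1) - Y i = dα i • v 0 i := by
    intro i
    have hp := parallel_of_cross (Y (i - 1) - Y i) (v 0 i) (hunit 0 i) (by
      have : cross3 (Y (i - 1) - Y i) (v 0 i)
          = cross3 (Y (i - 1)) (v 0 i) - cross3 (Y i) (v 0 i) := by
        ext k; fin_cases k <;> simp [cross3] <;> ring
      rw [this, ← hY1, ← hY2', sub_self])
    set a := dot3 (Y (i - 1) - Y i) (v 0 i) with ha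
    rw [hp]
    congr 1
    have hc := fun t => hcos t i
    have hs := hsin 0 i
    have hiso' : ∀ t, dot3 (v t (i - 1)) (v t i) = dot3 (v 0 (i - 1)) (v 0 i) := by
      intro t; simpa using hiso t (i - 1)
    simp only [hiso', hiso _ i] at hc
    generalize Real.sqrt (1 - dot3 (v 0 (i - 1)) (v 0 i) ^ 2) = S1 at hc hs
    generalize Real.sqrt (1 - dot3 (v 0 i) (v 0 (i + 1)) ^ 2) = S2 at hc hs
    have hd1 := (((hdα i).cos).mul_const S1).mul_const S2
    have hd2 := (hasDerivAt_dot3 (hdv (i - 1)) (hdv (i + 1))).sub_const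
      (dot3 (v 0 (i - 1)) (v 0 i) * dot3 (v 0 i) (v 0 (i + 1)))
    have hd := hd1.unique (hd2.congr_of_eventuallyEq (Filter.Eventually.of_forall hc))
    have hYi : Y i = Y (i - 1) - a • v 0 i := by rw [← hp]; abel
    have e : dot3 (dv (i - 1)) (v 0 (i + 1)) + dot3 (v 0 (i - 1)) (dv (i + 1))
        = - a * dot3 (v 0 i) (cross3 (v 0 (i + 1)) (v 0 (i - 1))) := by
      rw [hY1 (i - 1), hY2 i, hYi]
      simp [dot3, cross3]; ring
    rw [e, ← hs] at hd
    have hpos : 0 < Real.sin (α 0 i) * S1 * S2 := by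
      rw [hs]
      have := hdet i
      simp [dot3, cross3] at *
      linarith
    have : (Real.sin (α 0 i) * S1 * S2) * (a - dα i) = 0 := by linear_combination hd
    rcases mul_eq_zero.1 this with h | h
    · exact absurd h hpos.ne'
    · linarith
  intro j
  set u := v 0 j with hu
  set p : (Fin 3 → ℝ) → ℝ := fun x => dot3 (cross3 u (v 0 (j + 1))) x with hp
  set q : (Fin 3 → ℝ) → ℝ := fun x => dot3 (cross3 (v 0 (j - 1)) u) x with hq
  set l : (Fin 3 → ℝ) → ℝ := fun x => p x + q x with hl
  set K := p (v 0 (j - 1)) with hK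
  have hKpos : 0 < K := hdet j
  have hKdet : ∀ x y, K * dot3 (cross3 x y) u = l x * p y - p x * l y := by
    intro x y
    simp only [hK, hl, hp, hq]
    generalize u = u', v 0 (j + 1) = w, v 0 (j - 1) = z
    simp [dot3, cross3]; ring
  have hpu : p u = 0 := by simp [hp, dot3, cross3]; ring
  have hlu : l u = 0 := by simp [hl, hp, hq, dot3, cross3]; ring
  have p_sub : ∀ x y, p (x - y) = p x - p y := by
    intro x y; simp [hp, dot3]; ring
  have l_sub : ∀ x y, l (x - y) = l x - l y := by
    intro x y; simp [hl, hp, hq, dot3]; ring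
  have p_smul : ∀ (c : ℝ) x, p (c • x) = c * p x := by
    intro c x; simp [hp, dot3]; ring
  have l_smul : ∀ (c : ℝ) x, l (c • x) = c * l x := by
    intro c x; simp [hl, hp, hq, dot3]; ring
  have hlpos : ∀ m, m ≠ j → 0 < l (v 0 m) := by
    intro m hm
    have hq0 : m ≠ j - 1 → 0 < q (v 0 m) := fun h => by
      have := hconvex (j - 1) m h (by simpa using hm)
      simpa [hq] using this
    have hp0 : m ≠ j + 1 → 0 < p (v 0 m) := fun h => hconvex j m hm h
    by_cases h1 : m = j + 1
    · have : p (v 0 m) = 0 := by rw [h1]; simp [hp, dot3, cross3]; ring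
      simp only [hl]
      rw [this, zero_add]
      exact hq0 (by rw [h1]; exact (pp_ne j).symm)
    · by_cases h2 : m = j - 1
      · have : q (v 0 m) = 0 := by rw [h2]; simp [hq, dot3, cross3]; ring
        simp only [hl]
        rw [this, add_zero]
        exact hp0 h1
      · exact add_pos (hp0 h1) (hq0 h2)
  set s : ZMod n → ℝ := fun m => p (v 0 m) / l (v 0 m) with hs
  have hps : ∀ m, p (v 0 m) = s m * l (v 0 m) := by
    intro m
    by_cases hm : m = j
    · rw [hm, ← hu, hpu, hlu, mul_zero]
    · have := (hlpos m hm).ne'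
      simp only [hs]; field_simp
  have hslt : ∀ m, m ≠ j → m ≠ j - 1 → s m < s (m + 1) := by
    intro m h1 h2
    have h3 : m + 1 ≠ j := fun h => h2 (by rw [← h]; ring)
    simp only [hs]
    rw [div_lt_div_iff₀ (hlpos m h1) (hlpos _ h3)]
    have h4 := hKdet (v 0 m) (v 0 (m + 1))
    have h5 := mul_pos hKpos (hconvex m j (Ne.symm h1) (Ne.symm h3))
    rw [← hu] at h5
    linarith
  set Z : ZMod n → Fin 3 → ℝ := fun m => Y m - Y j with hZ
  have hZpar : ∀ m, Z (m - 1) - Z m = dα m • v 0 m := by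
    intro m; rw [← hpar m]; simp [hZ]
  set L : ZMod n → ℝ := fun m => l (Z m) with hL
  set P : ZMod n → ℝ := fun m => p (Z m) with hP
  have hLd : ∀ m, L (m - 1) - L m = dα m * l (v 0 m) := by
    intro m; simp only [hL]; rw [← l_sub, hZpar, l_smul]
  have hPd : ∀ m, P (m - 1) - P m = s m * (L (m - 1) - L m) := by
    intro m
    rw [hLd]
    simp only [hP]; rw [← p_sub, hZpar, p_smul, hps]; ring
  have hLj : L j = 0 := by simp [hL, hZ, hl, hp, hq, dot3]
  have hLj1 : L (j - 1) = 0 := by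
    have := hLd j
    rw [← hu, hlu, hLj] at this; linarith
  set F : ZMod n → ℝ := fun m =>
    K * dot3 (cross3 (Y j) (Z m)) u - P m * L m + s (m + 1) * L m ^ 2 with hF
  have hterm : ∀ m, K * dot3 (dα m • dv m) u
      = (F (m - 1) - F m) + (s (m + 1) - s m) * L m ^ 2 := by
    intro m
    have e1 : dot3 (dα m • dv m) u = dot3 (cross3 (Y j) (Z (m - 1))) u
        - dot3 (cross3 (Y j) (Z m)) u + dot3 (cross3 (Z m) (Z (m - 1))) u := by
      have e2 : Z (m - 1) = Z m + dα m • v 0 m := by rw [← hZpar]; abel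
      have e3 : Y m = Z m + Y j := by simp [hZ]
      rw [hY1 m, e2, e3]
      simp [dot3, cross3]; ring
    have e4 := hKdet (Z m) (Z (m - 1))
    change _ = L m * P (m - 1) - P m * L (m - 1) at e4
    rw [e1]
    simp only [hF, sub_add_cancel]
    linear_combination e4 + (L m + L (m - 1)) * hPd m
  have hsum : K * dot3 (∑ i, dα i • dv i) u = ∑ m, (s (m + 1) - s m) * L m ^ 2 := by
    have e : dot3 (∑ i, dα i • dv i) u = ∑ i, dot3 (dα i • dv i) u := by
      simp [dot3, Finset.sum_apply, Finset.sum_mul, Finset.sum_add_distrib]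
    rw [e, Finset.mul_sum, Finset.sum_congr rfl (fun m _ => hterm m), Finset.sum_add_distrib,
      sum_shift, zero_add]
  have hnn : ∀ m, 0 ≤ (s (m + 1) - s m) * L m ^ 2 := by
    intro m
    by_cases h1 : m = j
    · rw [h1, hLj]; simp
    by_cases h2 : m = j - 1
    · rw [h2, hLj1]; simp
    exact mul_nonneg (sub_nonneg.2 (hslt m h1 h2).le) (sq_nonneg _)
  have hS : 0 < ∑ m, (s (m + 1) - s m) * L m ^ 2 := by
    refine lt_of_le_of_ne (Finset.sum_nonneg fun m _ => hnn m) fun h0 => hnontriv ?_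
    have hz := (Finset.sum_eq_zero_iff_of_nonneg (fun m _ => hnn m)).1 h0.symm
    have hL0 : ∀ m, L m = 0 := by
      intro m
      by_cases h1 : m = j
      · rw [h1, hLj]
      by_cases h2 : m = j - 1
      · rw [h2, hLj1]
      rcases mul_eq_zero.1 (hz m (Finset.mem_univ _)) with h | h
      · exact absurd h (sub_pos.2 (hslt m h1 h2)).ne'
      · exact pow_eq_zero_iff (two_ne_zero) |>.1 h
    have hYs : ∀ m, m ≠ j → Y (m - 1) - Y m = 0 := by
      intro m hm
      have := hLd m
      rw [hL0, hL0, sub_zero] at this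
      rcases mul_eq_zero.1 this.symm with h | h
      · rw [hpar, h, zero_smul]
      · exact absurd h (hlpos m hm).ne'
    have hYj : Y (j - 1) - Y j = 0 := by
      rw [← sum_shift Y]
      exact (Finset.sum_eq_single j (fun m _ hm => hYs m hm) (by simp)).symm
    have hYc := zmod_const Y (fun m => sub_eq_zero.1 (by
      by_cases hm : m = j
      · rw [hm, hYj]
      · exact hYs m hm))
    exact ⟨Y 0, fun i => by rw [hY1 i, hYc i]⟩
  rw [← hsum] at hS
  exact (mul_pos_iff_of_pos_left hKpos).1 hS
end
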